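/- There exist positive real constants a and c such that for every integer n ≥ 1, the number GRR_3(n) of isomorphism classes of connected 3-valent graphical regular representations of order at most n satisfies GRR_3(n) ≥ n^{a·log n} − c (log denotes the natural logarithm). -/

import Mathlib

open SimpleGraph

/-- Finite graphs, presented as graphs on `Fin m` for some `m`. -/
def GSig := Σ m : ℕ, SimpleGraph (Fin m)

/-- Graphs satisfying `P`, up to isomorphism. -/
def graphSetoid (P : GSig → Prop) : Setoid {x : GSig // P x} where
  r a b := Nonempty (a.1.2 ≃g b.1.2)
  iseqv := ⟨fun _ => ⟨RelIso.refl _⟩, fun ⟨e⟩ => ⟨e.symm⟩, fun ⟨e⟩ ⟨f⟩ => ⟨e.trans f⟩⟩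

/-- The number of isomorphism classes of finite graphs satisfying `P`. -/
noncomputable def numIsoClasses (P : GSig → Prop) : ℕ :=
  Nat.card (Quotient (graphSetoid P))

/-- `Γ` is regular of valency `d`. -/
def DValent {V : Type*} (Γ : SimpleGraph V) (d : ℕ) : Prop :=
  ∀ v, (Γ.neighborSet v).ncard = d

/-- `Γ` is a graphical regular representation: its full automorphism group acts
regularly (sharply transitively) on the vertex set. -/
def IsGRR {V : Type*} (Γ : SimpleGraph V) : Prop :=
  ∀ u v : V, ∃! φ : Γ ≃g Γ, φ u = v

/-- `GRR_3(n)`: the number of isomorphism classes of connected 3-valent GRRs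
of order at most `n`. -/
noncomputable def grrCount (n : ℕ) : ℕ :=
  numIsoClasses (fun x => x.1 ≤ n ∧ x.2.Connected ∧ DValent x.2 3 ∧ IsGRR x.2)


/-! ### Cayley graphs of rigid triples of involutions -/

/-- Three generating involutions `x`, `b`, `c` whose Cayley graph determines the colours of its
edges: only the `x`- and `b`-edges lie on 4-cycles, and an 8-cycle alternating between `c`-edges
and other edges contains no `b`-edge. -/
structure RigidTriple (G : Type*) [Group G] where
  x : G
  b : G
  c : G
  x_mul_self : x * x = 1
  b_mul_self : b * b = 1
  c_mul_self : c * c = 1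
  x_ne_one : x ≠ 1
  b_ne_one : b ≠ 1
  c_ne_one : c ≠ 1
  x_ne_b : x ≠ b
  x_ne_c : x ≠ c
  b_ne_c : b ≠ c
  comm : x * b = b * x
  octagon : x * c * x * c * x * c * x * c = 1
  conj_ne : ∀ y z, (y = x ∨ y = b) → (z = x ∨ z = b) → c * y * c ≠ z
  b_octagon_ne : ∀ y z w, (y = x ∨ y = b) → (z = x ∨ z = b) → (w = x ∨ w = b) →
    b * c * y * c * z * c * w * c ≠ 1
  closure_eq : Subgroup.closure {x, b, c} = ⊤

namespace RigidTriple

variable {G G' : Type*} [Group G] [Group G']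

theorem mul_ne_self {g s : G} (hs : s ≠ 1) : g * s ≠ g := fun h => hs (by simpa using h)

/-- The Cayley graph of a rigid triple. -/
def graph (T : RigidTriple G) : SimpleGraph G where
  Adj g h := h = g * T.x ∨ h = g * T.b ∨ h = g * T.c
  symm := ⟨by
    rintro g h (rfl | rfl | rfl)
    · simp [mul_assoc, T.x_mul_self]
    · simp [mul_assoc, T.b_mul_self]
    · simp [mul_assoc, T.c_mul_self]⟩
  loopless := ⟨by
    rintro g (h | h | h)
    · exact mul_ne_self T.x_ne_one h.symm
    · exact mul_ne_self T.b_ne_one h.symm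
    · exact mul_ne_self T.c_ne_one h.symm⟩

theorem graph_adj (T : RigidTriple G) {g h : G} :
    T.graph.Adj g h ↔ h = g * T.x ∨ h = g * T.b ∨ h = g * T.c := Iff.rfl

/-- A set containing a point and closed under right multiplication by the generators is full. -/
theorem induction_right (T : RigidTriple G) {p : G → Prop} {u : G} (hu : p u)
    (hx : ∀ g, p g → p (g * T.x)) (hb : ∀ g, p g → p (g * T.b)) (hc : ∀ g, p g → p (g * T.c))
    (g : G) : p g := by
  have inv_of {s : G} (hs : s * s = 1) : s⁻¹ = s := inv_eq_of_mul_eq_one_left hs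
  have key : ∀ h ∈ Subgroup.closure {T.x, T.b, T.c}, p (u * h) := by
    intro h hh
    have step : ∀ g, ∀ s ∈ ({T.x, T.b, T.c} : Set G), p (u * g) → p (u * (g * s)) := by
      rintro g s (rfl | rfl | rfl) hg <;> rw [← mul_assoc]
      exacts [hx _ hg, hb _ hg, hc _ hg]
    induction hh using Subgroup.closure_induction_right with
    | one => simpa using hu
    | mul_right g _ s hs ih => exact step g s hs ih
    | mul_inv_cancel g _ s hs ih =>
      have : s⁻¹ = s := by
        rcases hs with rfl | rfl | rfl
        exacts [inv_of T.x_mul_self, inv_of T.b_mul_self, inv_of T.c_mul_self]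
      rw [this]
      exact step g s hs ih
  simpa using key (u⁻¹ * g) (by rw [T.closure_eq]; trivial)

theorem dValent_graph (T : RigidTriple G) : DValent T.graph 3 := by
  intro v
  have : T.graph.neighborSet v = {v * T.x, v * T.b, v * T.c} := by
    ext w; simp [graph_adj]
  rw [this, Set.ncard_eq_three]
  exact ⟨_, _, _, by simpa using T.x_ne_b, by simpa using T.x_ne_c, by simpa using T.b_ne_c, rfl⟩

theorem connected_graph (T : RigidTriple G) : T.graph.Connected := by
  have key : ∀ g, T.graph.Reachable 1 g :=
    T.induction_right (Reachable.refl 1)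
      (fun g hg => hg.trans (Adj.reachable (T.graph_adj.2 (Or.inl rfl))))
      (fun g hg => hg.trans (Adj.reachable (T.graph_adj.2 (Or.inr (Or.inl rfl)))))
      (fun g hg => hg.trans (Adj.reachable (T.graph_adj.2 (Or.inr (Or.inr rfl)))))
  have : Nonempty G := ⟨1⟩
  exact ⟨fun u v => (key u).symm.trans (key v)⟩

/-- The edge from `v` to `w` lies on a 4-cycle. -/
def OnSquare {V : Type*} (Γ : SimpleGraph V) (v w : V) : Prop :=
  ∃ p q, Γ.Adj v w ∧ Γ.Adj w p ∧ Γ.Adj p q ∧ Γ.Adj q v ∧ v ≠ p ∧ w ≠ q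

theorem OnSquare.map {V W : Type*} {Γ : SimpleGraph V} {Δ : SimpleGraph W} (φ : Γ ≃g Δ) {v w : V}
    (h : OnSquare Γ v w) : OnSquare Δ (φ v) (φ w) := by
  obtain ⟨p, q, h1, h2, h3, h4, h5, h6⟩ := h
  exact ⟨φ p, φ q, φ.map_adj_iff.2 h1, φ.map_adj_iff.2 h2, φ.map_adj_iff.2 h3, φ.map_adj_iff.2 h4,
    φ.injective.ne h5, φ.injective.ne h6⟩

theorem onSquare_x (T : RigidTriple G) (v : G) : OnSquare T.graph v (v * T.x) := by
  refine ⟨v * T.x * T.b, v * T.b, by simp [graph_adj], by simp [graph_adj], ?_, ?_, ?_, ?_⟩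
  · left; rw [mul_assoc v, T.comm, ← mul_assoc, mul_assoc, T.x_mul_self, mul_one]
  · right; left; rw [mul_assoc, T.b_mul_self, mul_one]
  · intro h
    have h1 : T.x * T.b = 1 := by simpa [mul_assoc] using h
    exact T.x_ne_b (mul_right_cancel (h1.trans T.b_mul_self.symm))
  · simpa using T.x_ne_b

theorem onSquare_b (T : RigidTriple G) (v : G) : OnSquare T.graph v (v * T.b) := by
  refine ⟨v * T.b * T.x, v * T.x, by simp [graph_adj], by simp [graph_adj], ?_, ?_, ?_, ?_⟩
  · right; left; rw [mul_assoc v, ← T.comm, ← mul_assoc, mul_assoc, T.b_mul_self, mul_one]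
  · left; rw [mul_assoc, T.x_mul_self, mul_one]
  · intro h
    have h1 : T.b * T.x = 1 := by simpa [mul_assoc] using h
    exact T.x_ne_b (mul_right_cancel (h1.trans T.x_mul_self.symm)).symm
  · simpa using T.x_ne_b.symm

theorem not_onSquare_c (T : RigidTriple G) (v : G) : ¬ OnSquare T.graph v (v * T.c) := by
  have hxx := T.x_mul_self
  have hbb := T.b_mul_self
  have hcc := T.c_mul_self
  rintro ⟨p, q, -, h2, h3, h4, h5, h6⟩
  obtain ⟨y, hy, rfl⟩ : ∃ y, (y = T.x ∨ y = T.b) ∧ p = v * T.c * y := by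
    rcases h2 with h | h | h
    · exact ⟨_, Or.inl rfl, h⟩
    · exact ⟨_, Or.inr rfl, h⟩
    · exact absurd (by rw [h, mul_assoc, hcc, mul_one]) h5
  obtain ⟨z, hz, rfl⟩ : ∃ z, (z = T.x ∨ z = T.b) ∧ q = v * z := by
    rcases h4.symm with h | h | h
    · exact ⟨_, Or.inl rfl, h⟩
    · exact ⟨_, Or.inr rfl, h⟩
    · exact absurd h.symm h6
  have hbx : T.b * T.x * T.b = T.x := by rw [← T.comm, mul_assoc, hbb, mul_one]
  have h3' : z = T.c * y * T.x ∨ z = T.c * y * T.b ∨ z = T.c * y * T.c := by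
    simpa only [graph_adj, mul_assoc, mul_right_inj] using h3
  have hyy : y * y = 1 := by rcases hy with rfl | rfl <;> assumption
  have hzc : z ≠ T.c := by
    rcases hz with rfl | rfl
    · exact T.x_ne_c
    · exact T.b_ne_c
  have aux : ∀ s, (s = T.x ∨ s = T.b) → z ≠ T.c * y * s := by
    intro s hs h
    have hcs : z * s * y = T.c := by
      rw [h]
      have hss : s * s = 1 := by rcases hs with rfl | rfl <;> assumption
      rw [mul_assoc (T.c * y), hss, mul_one, mul_assoc, hyy, mul_one]
    have : T.c = T.x ∨ T.c = T.b := by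
      rw [← hcs]
      rcases hz with rfl | rfl <;> rcases hs with rfl | rfl <;> rcases hy with rfl | rfl <;>
        simp [hxx, hbb, hbx, mul_assoc, T.comm]
    rcases this with h | h
    · exact T.x_ne_c h.symm
    · exact T.b_ne_c h.symm
  rcases h3' with h | h | h
  · exact aux _ (Or.inl rfl) h
  · exact aux _ (Or.inr rfl) h
  · exact T.conj_ne y z hy hz h.symm

theorem map_mul_c (T : RigidTriple G) (T' : RigidTriple G') (φ : T.graph ≃g T'.graph) (v : G) :
    φ (v * T.c) = φ v * T'.c := by
  have h : T'.graph.Adj (φ v) (φ (v * T.c)) := φ.map_adj_iff.2 (by simp [graph_adj])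
  have hn : ¬ OnSquare T'.graph (φ v) (φ (v * T.c)) := fun hq =>
    T.not_onSquare_c v (by simpa using hq.map φ.symm)
  rcases h with h | h | h
  · exact absurd (h ▸ T'.onSquare_x _) hn
  · exact absurd (h ▸ T'.onSquare_b _) hn
  · exact h

theorem map_mul_x_or (T : RigidTriple G) (T' : RigidTriple G') (φ : T.graph ≃g T'.graph) (v : G) :
    ∃ y, (y = T'.x ∨ y = T'.b) ∧ φ (v * T.x) = φ v * y := by
  have h : T'.graph.Adj (φ v) (φ (v * T.x)) := φ.map_adj_iff.2 (by simp [graph_adj])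
  rcases h with h | h | h
  · exact ⟨_, Or.inl rfl, h⟩
  · exact ⟨_, Or.inr rfl, h⟩
  · exact absurd ((T.onSquare_x v).map φ) (h ▸ T'.not_onSquare_c _)

theorem map_mul_x (T : RigidTriple G) (T' : RigidTriple G') (φ : T.graph ≃g T'.graph) (v : G) :
    φ (v * T.x) = φ v * T'.x := by
  obtain ⟨y₁, h₁ | h₁, e₁⟩ := T.map_mul_x_or T' φ v
  · rw [e₁, h₁]
  obtain ⟨y₂, h₂, e₂⟩ := T.map_mul_x_or T' φ (v * T.x * T.c)
  obtain ⟨y₃, h₃, e₃⟩ := T.map_mul_x_or T' φ (v * T.x * T.c * T.x * T.c)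
  obtain ⟨y₄, h₄, e₄⟩ := T.map_mul_x_or T' φ (v * T.x * T.c * T.x * T.c * T.x * T.c)
  have hv : v * T.x * T.c * T.x * T.c * T.x * T.c * T.x * T.c = v := by
    simpa only [mul_assoc, mul_one] using congrArg (v * ·) T.octagon
  have h := congrArg φ hv
  rw [map_mul_c, e₄, map_mul_c, e₃, map_mul_c, e₂, map_mul_c, e₁, h₁] at h
  exact absurd (by simpa [mul_assoc] using h) (T'.b_octagon_ne y₂ y₃ y₄ h₂ h₃ h₄)

theorem map_mul_b (T : RigidTriple G) (T' : RigidTriple G') (φ : T.graph ≃g T'.graph) (v : G) :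
    φ (v * T.b) = φ v * T'.b := by
  have h : T'.graph.Adj (φ v) (φ (v * T.b)) := φ.map_adj_iff.2 (by simp [graph_adj])
  rcases h with h | h | h
  · rw [← T.map_mul_x T'] at h
    exact absurd (mul_left_cancel (φ.injective h)).symm T.x_ne_b
  · exact h
  · rw [← T.map_mul_c T'] at h
    exact absurd (mul_left_cancel (φ.injective h)) T.b_ne_c

/-- Left translations are automorphisms of the Cayley graph. -/
def translation (T : RigidTriple G) (g : G) : T.graph ≃g T.graph where
  toEquiv := Equiv.mulLeft g
  map_rel_iff' := by intro u v; simp [graph_adj, mul_assoc]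

theorem isGRR_graph (T : RigidTriple G) : IsGRR T.graph := by
  intro u v
  refine ⟨T.translation (v * u⁻¹), by simp [translation], fun φ hφ => ?_⟩
  have key (ψ χ : T.graph ≃g T.graph) (h : ψ u = χ u) : ψ = χ := by
    ext g
    refine T.induction_right (p := fun g => ψ g = χ g) h ?_ ?_ ?_ g
    · intro g hg; rw [T.map_mul_x T, T.map_mul_x T, hg]
    · intro g hg; rw [T.map_mul_b T, T.map_mul_b T, hg]
    · intro g hg; rw [T.map_mul_c T, T.map_mul_c T, hg]
  exact key _ _ (by simp [hφ, translation])

/-- Isomorphic Cayley graphs of rigid triples come from isomorphic triples. -/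
theorem exists_hom (T : RigidTriple G) (T' : RigidTriple G') (φ : T.graph ≃g T'.graph) :
    ∃ ψ : G →* G', ψ T.x = T'.x ∧ ψ T.b = T'.b ∧ ψ T.c = T'.c := by
  have hmul : ∀ g h, φ (g * h) = φ g * ((φ 1)⁻¹ * φ h) := by
    intro g
    refine T.induction_right (u := 1) (by simp) ?_ ?_ ?_
    · intro h hh; rw [← mul_assoc, T.map_mul_x T', T.map_mul_x T', hh]; simp [mul_assoc]
    · intro h hh; rw [← mul_assoc, T.map_mul_b T', T.map_mul_b T', hh]; simp [mul_assoc]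
    · intro h hh; rw [← mul_assoc, T.map_mul_c T', T.map_mul_c T', hh]; simp [mul_assoc]
  refine ⟨MonoidHom.mk' (fun g => (φ 1)⁻¹ * φ g) fun g h => by
    rw [hmul]; simp [mul_assoc], ?_, ?_, ?_⟩
  · simpa using congrArg ((φ 1)⁻¹ * ·) (T.map_mul_x T' φ 1)
  · simpa using congrArg ((φ 1)⁻¹ * ·) (T.map_mul_b T' φ 1)
  · simpa using congrArg ((φ 1)⁻¹ * ·) (T.map_mul_c T' φ 1)

end RigidTriple

/-! ### Twisted lamplighter groups -/

namespace Lamp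

variable {m : ℕ} {R : Type*}

/-- Lamp configurations on the cycle `ZMod m` together with a twist indexed by the two
orientations of the cycle. -/
abbrev Config (m : ℕ) (R : Type*) := (ZMod m → ZMod 2) × (ℤˣ → R)

/-- The action of the affine map `i ↦ δ * i + s` on configurations. -/
def affine (δ : ℤˣ) (s : ZMod m) (u : Config m R) : Config m R :=
  (fun i => u.1 (((δ : ℤ) : ZMod m) * i + s), fun ε => u.2 (δ * ε))

theorem affine_affine (δ δ' : ℤˣ) (s s' : ZMod m) (u : Config m R) :
    affine δ s (affine δ' s' u) = affine (δ' * δ) (((δ' : ℤ) : ZMod m) * s + s') u := by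
  refine Prod.ext ?_ ?_
  · funext i
    simp only [affine, Units.val_mul, Int.cast_mul]
    ring_nf
  · funext ε
    simp only [affine, mul_assoc]

theorem affine_one_zero (u : Config m R) : affine 1 0 u = u := by
  simp [affine]

/-- The reflection `i ↦ s - i` of the cycle of lamps. -/
def refl (R : Type*) (s : ZMod m) : Equiv.Perm (Config m R) :=
  Function.Involutive.toPerm (affine (-1) s) fun u => by
    rw [affine_affine]; simp [affine]

theorem refl_apply (s : ZMod m) (u : Config m R) : refl R s u = affine (-1) s u := rfl

theorem refl_mul_self (s : ZMod m) : refl R s * refl R s = 1 := by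
  ext1 u
  exact (refl R s).left_inv u

theorem refl_mul_refl_mul_refl (s t : ZMod m) :
    refl R s * refl R t * refl R s = refl R (2 * s - t) := by
  ext1 u
  simp only [Equiv.Perm.mul_apply, refl_apply, affine_affine]
  simp
  ring_nf

theorem refl_apply_fst (s : ZMod m) (u : Config m R) (i : ZMod m) :
    (refl R s u).1 i = u.1 (s - i) := by
  simp [refl_apply, affine, sub_eq_neg_add]

theorem natCast_ne_zero {k : ℕ} (hk : 0 < k) (hm : k < m) : (k : ZMod m) ≠ 0 := fun h =>
  absurd (Nat.le_of_dvd hk ((ZMod.natCast_eq_zero_iff _ _).1 h)) (not_le.2 hm)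

variable [AddCommGroup R]

theorem refl_injective : Function.Injective (refl R : ZMod m → Equiv.Perm (Config m R)) := by
  intro s t h
  have := congrArg (fun σ : Equiv.Perm (Config m R) => (σ (Pi.single s 1, 0)).1 0) h
  simpa [refl_apply_fst, Pi.single_apply, eq_comm] using this

theorem refl_ne_one (hm : 4 < m) (s : ZMod m) : refl R s ≠ 1 := by
  intro h
  have key (k : ZMod m) : s - k = k := by
    have := congrArg (fun σ : Equiv.Perm (Config m R) => (σ (Pi.single k 1, 0)).1 k) h
    simpa [refl_apply_fst, Pi.single_apply] using this
  have h2 : ((2 : ℕ) : ZMod m) = 0 := by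
    push_cast
    linear_combination key 0 - key 1
  exact natCast_ne_zero two_pos (by omega) h2

/-- The central translation by `y`. -/
def twist (y : ℤˣ → R) : Equiv.Perm (Config m R) where
  toFun u := (u.1, y + u.2)
  invFun u := (u.1, -y + u.2)
  left_inv u := by simp
  right_inv u := by simp

theorem twist_apply (y : ℤˣ → R) (u : Config m R) : twist y u = (u.1, y + u.2) := rfl

theorem twist_add (y z : ℤˣ → R) :
    (twist (y + z) : Equiv.Perm (Config m R)) = twist y * twist z := by
  ext1 u
  simp [twist_apply, Equiv.Perm.mul_apply, add_assoc]

theorem twist_zero : (twist 0 : Equiv.Perm (Config m R)) = 1 := by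
  ext1 u
  simp [twist_apply]

theorem twist_injective : Function.Injective (twist : (ℤˣ → R) → Equiv.Perm (Config m R)) := by
  intro y z h
  simpa [twist_apply] using congrArg Prod.snd (congrArg (fun σ : Equiv.Perm (Config m R) => σ 0) h)

variable [NeZero m] [Module (ZMod 2) R]

/-- The bilinear form on lamp configurations with values determined by `f`. -/
def form (f : ZMod m → R) (a u : ZMod m → ZMod 2) : ℤˣ → R := fun ε =>
  ∑ i, ∑ j, (a i * u j) • f (((ε : ℤ) : ZMod m) * (j - i))

/-- The twisted translation by a configuration `p`. -/
def transl (f : ZMod m → R) (p u : Config m R) : Config m R :=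
  (p.1 + u.1, p.2 + u.2 + form f p.1 u.1)

theorem form_add_left (f : ZMod m → R) (a a' u : ZMod m → ZMod 2) :
    form f (a + a') u = form f a u + form f a' u := by
  ext ε
  simp [form, add_mul, add_smul, Finset.sum_add_distrib]

theorem form_add_right (f : ZMod m → R) (a u u' : ZMod m → ZMod 2) :
    form f a (u + u') = form f a u + form f a u' := by
  ext ε
  simp [form, mul_add, add_smul, Finset.sum_add_distrib]

@[simp] theorem form_zero_right (f : ZMod m → R) (a : ZMod m → ZMod 2) : form f a 0 = 0 := by
  ext ε
  simp [form]

@[simp] theorem form_zero_left (f : ZMod m → R) (a : ZMod m → ZMod 2) : form f 0 a = 0 := by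
  ext ε
  simp [form]

theorem form_single (f : ZMod m → R) (i j : ZMod m) (ε : ℤˣ) :
    form f (Pi.single i 1) (Pi.single j 1) ε = f (((ε : ℤ) : ZMod m) * (j - i)) := by
  unfold form
  rw [Finset.sum_eq_single i, Finset.sum_eq_single j] <;> simp +contextual [Pi.single_apply]

theorem form_affine (f : ZMod m → R) (δ : ℤˣ) (s : ZMod m) (a u : Config m R) (ε : ℤˣ) :
    form f (affine δ s a).1 (affine δ s u).1 ε = form f a.1 u.1 (δ * ε) := by
  have hδ : ((δ : ℤ) : ZMod m) * ((δ : ℤ) : ZMod m) = 1 := by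
    rw [← Int.cast_mul, ← Units.val_mul, Int.units_mul_self]; simp
  let e : ZMod m ≃ ZMod m :=
    { toFun := fun i => ((δ : ℤ) : ZMod m) * i + s
      invFun := fun i => ((δ : ℤ) : ZMod m) * (i - s)
      left_inv := fun i => by linear_combination i * hδ
      right_inv := fun i => by linear_combination (i - s) * hδ }
  unfold form affine
  refine Fintype.sum_equiv e _ _ fun i => Fintype.sum_equiv e _ _ fun j => ?_
  congr 2
  simp only [e, Equiv.coe_fn_mk, Units.val_mul, Int.cast_mul]
  linear_combination -((ε : ℤ) : ZMod m) * (j - i) * hδ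

theorem affine_transl (f : ZMod m → R) (δ : ℤˣ) (s : ZMod m) (p u : Config m R) :
    affine δ s (transl f p u) = transl f (affine δ s p) (affine δ s u) := by
  refine Prod.ext rfl ?_
  ext ε
  simp only [transl, Pi.add_apply, form_affine]
  rfl

theorem transl_transl (f : ZMod m → R) (p q u : Config m R) :
    transl f p (transl f q u) = transl f (transl f p q) u := by
  refine Prod.ext ?_ ?_
  · simp only [transl, add_assoc]
  · simp only [transl, form_add_left, form_add_right]
    abel

/-- Switching the lamp at `k`. -/
def lamp (f : ZMod m → R) (hf : f 0 = 0) (k : ZMod m) : Equiv.Perm (Config m R) :=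
  Function.Involutive.toPerm (transl f (Pi.single k 1, 0)) fun u => by
    have h1 : (Pi.single k 1 + Pi.single k 1 : ZMod m → ZMod 2) = 0 := by
      ext i; exact CharTwo.add_self_eq_zero _
    have h2 : form f (Pi.single k 1) (Pi.single k 1) = 0 := by
      ext ε; rw [form_single]; simp [hf]
    rw [transl_transl]
    simp [transl, h1, h2]

theorem lamp_apply (f : ZMod m → R) (hf : f 0 = 0) (k : ZMod m) (u : Config m R) :
    lamp f hf k u = transl f (Pi.single k 1, 0) u := rfl

theorem lamp_mul_self (f : ZMod m → R) (hf : f 0 = 0) (k : ZMod m) :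
    lamp f hf k * lamp f hf k = 1 := by
  ext1 u
  exact (lamp f hf k).left_inv u

theorem refl_mul_lamp_mul_refl (f : ZMod m → R) (hf : f 0 = 0) (s k : ZMod m) :
    refl R s * lamp f hf k * refl R s = lamp f hf (s - k) := by
  ext1 u
  have h : affine (-1) s ((Pi.single k 1, 0) : Config m R) = (Pi.single (s - k) 1, 0) := by
    refine Prod.ext ?_ rfl
    funext i
    have : -i + s = k ↔ i = s - k := by
      constructor <;> intro h <;> linear_combination -h
    simp [affine, Pi.single_apply, this]
  simp only [Equiv.Perm.mul_apply, lamp_apply, refl_apply, affine_transl, h]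
  rw [← refl_apply, ← refl_apply, ← Equiv.Perm.mul_apply, refl_mul_self, Equiv.Perm.one_apply]

theorem commutator_lamp (f : ZMod m → R) (hf : f 0 = 0) (k : ZMod m) :
    lamp f hf 0 * lamp f hf k * lamp f hf 0 * lamp f hf k =
      twist fun _ => f k + f (-k) := by
  ext1 u
  simp only [Equiv.Perm.mul_apply, lamp_apply, transl_transl]
  have h1 (i : ZMod m) : (Pi.single i 1 + Pi.single i 1 : ZMod m → ZMod 2) = 0 := by
    ext i; exact CharTwo.add_self_eq_zero _
  have h2 (i : ZMod m) : form f (Pi.single i 1) (Pi.single i 1) = 0 := by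
    ext ε; rw [form_single]; simp [hf]
  have h3 :
      (Pi.single 0 1 + Pi.single k 1 + Pi.single 0 1 + Pi.single k 1 : ZMod m → ZMod 2) = 0 := by
    rw [add_right_comm (Pi.single 0 1), h1, zero_add, h1]
  simp only [transl, h3, form_add_left, h2, twist_apply]
  refine Prod.ext (by simp) ?_
  funext ε
  rcases Int.units_eq_one_or ε with rfl | rfl <;>
    simp [form_single, ZModModule.add_self, add_comm]

/-- The group generated by a lamp and two reflections. -/
def group (f : ZMod m → R) (hf : f 0 = 0) : Subgroup (Equiv.Perm (Config m R)) :=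
  Subgroup.closure {lamp f hf 0, refl R 0, refl R 1}

theorem lamp_mem (f : ZMod m → R) (hf : f 0 = 0) : lamp f hf 0 ∈ group f hf :=
  Subgroup.subset_closure (by simp)

theorem refl_zero_mem (f : ZMod m → R) (hf : f 0 = 0) : refl R 0 ∈ group f hf :=
  Subgroup.subset_closure (by simp)

theorem refl_one_mem (f : ZMod m → R) (hf : f 0 = 0) : refl R 1 ∈ group f hf :=
  Subgroup.subset_closure (by simp)

theorem exists_eq_of_mem_group (f : ZMod m → R) (hf : f 0 = 0) {σ : Equiv.Perm (Config m R)}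
    (hσ : σ ∈ group f hf) : ∃ (p : Config m R) (δ : ℤˣ) (s : ZMod m),
      ∀ u, σ u = transl f p (affine δ s u) := by
  have hlamp : ∀ σ : Equiv.Perm (Config m R), (∃ (p : Config m R) (δ : ℤˣ) (s : ZMod m),
      ∀ u, σ u = transl f p (affine δ s u)) → ∃ (p : Config m R) (δ : ℤˣ) (s : ZMod m),
      ∀ u, (lamp f hf 0 * σ) u = transl f p (affine δ s u) := by
    rintro σ ⟨p, δ, s, h⟩
    exact ⟨_, δ, s, fun u => by rw [Equiv.Perm.mul_apply, lamp_apply, h, transl_transl]⟩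
  have hrefl : ∀ (t : ZMod m) (σ : Equiv.Perm (Config m R)), (∃ (p : Config m R) (δ : ℤˣ)
      (s : ZMod m), ∀ u, σ u = transl f p (affine δ s u)) → ∃ (p : Config m R) (δ : ℤˣ)
      (s : ZMod m), ∀ u, (refl R t * σ) u = transl f p (affine δ s u) := by
    rintro t σ ⟨p, δ, s, h⟩
    exact ⟨_, _, _, fun u => by
      rw [Equiv.Perm.mul_apply, refl_apply, h, affine_transl, affine_affine]⟩
  induction hσ using Subgroup.closure_induction_left with
  | one => exact ⟨0, 1, 0, fun u => by simp [affine_one_zero, transl]⟩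
  | mul_left σ hσ τ _ ih =>
    rcases hσ with rfl | rfl | rfl
    exacts [hlamp _ ih, hrefl _ _ ih, hrefl _ _ ih]
  | inv_mul_cancel σ hσ τ _ ih =>
    rcases hσ with rfl | rfl | rfl
    · rw [inv_eq_of_mul_eq_one_left (lamp_mul_self f hf 0)]; exact hlamp _ ih
    · rw [inv_eq_of_mul_eq_one_left (refl_mul_self _)]; exact hrefl _ _ ih
    · rw [inv_eq_of_mul_eq_one_left (refl_mul_self _)]; exact hrefl _ _ ih

theorem card_group_le (f : ZMod m → R) (hf : f 0 = 0) [Finite R] :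
    Nat.card (group f hf) ≤ 2 ^ m * Nat.card R ^ 2 * (2 * m) := by
  choose p δ s h using fun σ : group f hf => exists_eq_of_mem_group f hf σ.2
  have hinj : Function.Injective fun σ => (p σ, δ σ, s σ) := by
    intro σ τ hστ
    simp only [Prod.mk.injEq] at hστ
    refine Subtype.ext (Equiv.ext fun u => ?_)
    rw [h, h, hστ.1, hστ.2.1, hστ.2.2]
  refine (Nat.card_le_card_of_injective _ hinj).trans_eq ?_
  simp [Nat.card_prod, Nat.card_fun]

theorem lamp_apply_fst (f : ZMod m → R) (hf : f 0 = 0) (k : ZMod m) (u : Config m R) (i : ZMod m) :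
    (lamp f hf k u).1 i = (if i = k then 1 else 0) + u.1 i := by
  simp [lamp_apply, transl, Pi.single_apply]

theorem lamp_ne_one (f : ZMod m → R) (hf : f 0 = 0) (k : ZMod m) : lamp f hf k ≠ 1 := by
  intro h
  have := congrArg (fun σ : Equiv.Perm (Config m R) => (σ 0).1 k) h
  simp [lamp_apply_fst] at this

theorem lamp_ne_refl (f : ZMod m → R) (hf : f 0 = 0) (k s : ZMod m) :
    lamp f hf k ≠ refl R s := by
  intro h
  have := congrArg (fun σ : Equiv.Perm (Config m R) => (σ 0).1 k) h
  simp [lamp_apply_fst, refl_apply_fst] at this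

theorem lamp_injective (f : ZMod m → R) (hf : f 0 = 0) : Function.Injective (lamp f hf) := by
  intro k l h
  have := congrArg (fun σ : Equiv.Perm (Config m R) => (σ 0).1 k) h
  simpa [lamp_apply_fst] using this

theorem octagon_ne_one (f : ZMod m → R) (hf : f 0 = 0) (hm : 4 < m)
    {y z w : Equiv.Perm (Config m R)}
    (hy : y = lamp f hf 1 ∨ y = refl R 2) (hz : z = lamp f hf 0 ∨ z = refl R 0)
    (hw : w = lamp f hf 1 ∨ w = refl R 2) : refl R 0 * y * z * w ≠ 1 := by
  intro h
  have ev (u : Config m R) (i : ZMod m) :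
      ((refl R 0 * y * z * w : Equiv.Perm (Config m R)) u).1 i = u.1 i := by
    rw [h]; rfl
  have h1 : (1 : ZMod m) ≠ 0 := by
    simpa using natCast_ne_zero (m := m) (k := 1) one_pos (by omega)
  have h2 : (2 : ZMod m) ≠ 0 := by
    simpa using natCast_ne_zero (m := m) (k := 2) two_pos (by omega)
  have h4 : (4 : ZMod m) ≠ 0 := by
    simpa using natCast_ne_zero (m := m) (k := 4) four_pos (by omega)
  rcases hy with rfl | rfl <;> rcases hz with rfl | rfl <;> rcases hw with rfl | rfl
  · have := ev 0 0
    simp [lamp_apply_fst, refl_apply_fst, h1.symm] at this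
  · have := ev 0 0
    simp [lamp_apply_fst, refl_apply_fst, h1.symm] at this
  · have := ev 0 1
    have h3 : (-1 : ZMod m) ≠ 1 := fun h => h2 (by linear_combination -h)
    simp [lamp_apply_fst, refl_apply_fst, h3] at this
  · have := ev 0 (-1)
    simp [lamp_apply_fst, refl_apply_fst] at this
  · have := ev 0 (-1)
    have h3 : (2 - 1 : ZMod m) = 1 := by ring
    simp [lamp_apply_fst, refl_apply_fst, h3, h1] at this
  · have := ev 0 (-2)
    simp [lamp_apply_fst, refl_apply_fst] at this
  · have := ev 0 (-3)
    have h3 : (3 - 2 : ZMod m) = 1 := by ring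
    simp [lamp_apply_fst, refl_apply_fst, h3] at this
  · have := ev (Pi.single 0 1, 0) (-4)
    have h5 : (2 - (4 - 2) : ZMod m) = 0 := by ring
    simp [refl_apply_fst, h4, h5] at this

/-- The defining generators of the twisted lamplighter group form a rigid triple. -/
def rigidTriple (f : ZMod m → R) (hf : f 0 = 0) (hf1 : f 1 + f (-1) = 0) (hm : 4 < m) :
    RigidTriple (group f hf) where
  x := ⟨lamp f hf 0, lamp_mem f hf⟩
  b := ⟨refl R 0, refl_zero_mem f hf⟩
  c := ⟨refl R 1, refl_one_mem f hf⟩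
  x_mul_self := Subtype.ext (lamp_mul_self f hf 0)
  b_mul_self := Subtype.ext (refl_mul_self 0)
  c_mul_self := Subtype.ext (refl_mul_self 1)
  x_ne_one h := lamp_ne_one f hf 0 (congrArg Subtype.val h)
  b_ne_one h := refl_ne_one hm 0 (congrArg Subtype.val h)
  c_ne_one h := refl_ne_one hm 1 (congrArg Subtype.val h)
  x_ne_b h := lamp_ne_refl f hf 0 0 (congrArg Subtype.val h)
  x_ne_c h := lamp_ne_refl f hf 0 1 (congrArg Subtype.val h)
  b_ne_c h := by
    have h1 : ((1 : ℕ) : ZMod m) = 0 := by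
      simpa using (refl_injective (R := R) (congrArg Subtype.val h)).symm
    exact natCast_ne_zero one_pos (by omega) h1
  comm := Subtype.ext <| by
    have h := refl_mul_lamp_mul_refl f hf 0 0
    rw [sub_zero] at h
    change lamp f hf 0 * refl R 0 = refl R 0 * lamp f hf 0
    conv_lhs => rw [← h]
    rw [mul_assoc, refl_mul_self, mul_one]
  octagon := Subtype.ext <| by
    have h := refl_mul_lamp_mul_refl f hf 1 0
    rw [sub_zero] at h
    have h' := commutator_lamp f hf 1
    have hF : (fun _ => f 1 + f (-1) : ℤˣ → R) = 0 := funext fun _ => hf1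
    rw [hF, twist_zero, ← h] at h'
    simpa only [mul_assoc, Subgroup.coe_mul, Subgroup.coe_one] using h'
  conj_ne := by
    have h0 := refl_mul_lamp_mul_refl f hf 1 0
    have h1 := refl_mul_refl_mul_refl (R := R) (1 : ZMod m) 0
    have n1 : (1 : ZMod m) ≠ 0 := by
      simpa using natCast_ne_zero (m := m) (k := 1) one_pos (by omega)
    have n2 : (2 : ZMod m) ≠ 0 := by
      simpa using natCast_ne_zero (m := m) (k := 2) two_pos (by omega)
    rintro _ _ (rfl | rfl) (rfl | rfl) h <;> replace h := congrArg Subtype.val h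
    · exact n1 (by simpa using lamp_injective f hf (h0.symm.trans h))
    · exact lamp_ne_refl f hf _ _ (h0.symm.trans h)
    · exact lamp_ne_refl f hf _ _ (h.symm.trans h1)
    · exact n2 (by simpa using refl_injective (R := R) (h1.symm.trans h))
  b_octagon_ne := by
    have key : ∀ y : group f hf, (y = ⟨lamp f hf 0, lamp_mem f hf⟩ ∨
        y = ⟨refl R 0, refl_zero_mem f hf⟩) →
        refl R 1 * y.1 * refl R 1 = lamp f hf 1 ∨ refl R 1 * y.1 * refl R 1 = refl R 2 := by
      rintro _ (rfl | rfl)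
      · left; simpa using refl_mul_lamp_mul_refl f hf 1 0
      · right; simpa using refl_mul_refl_mul_refl (R := R) (1 : ZMod m) 0
    intro y z w hy hz hw h
    refine octagon_ne_one f hf hm (key y hy) (z := z.1) ?_ (key w hw) ?_
    · rcases hz with rfl | rfl
      · exact Or.inl rfl
      · exact Or.inr rfl
    · simpa [mul_assoc] using congrArg Subtype.val h
  closure_eq := by
    refine Eq.trans ?_ (Subgroup.closure_closure_coe_preimage
      (k := {lamp f hf 0, refl R 0, refl R 1}))
    congr 1
    ext σ
    simp only [Set.mem_insert_iff, Set.mem_singleton_iff, Subtype.ext_iff]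
    rfl

/-- A homomorphism matching the generators relates the commutators of lamps. -/
theorem exists_twist {f f' : ZMod m → R} {hf : f 0 = 0} {hf' : f' 0 = 0}
    (ψ : group f hf →* group f' hf')
    (hx : ψ ⟨lamp f hf 0, lamp_mem f hf⟩ = ⟨lamp f' hf' 0, lamp_mem f' hf'⟩)
    (hb : ψ ⟨refl R 0, refl_zero_mem f hf⟩ = ⟨refl R 0, refl_zero_mem f' hf'⟩)
    (hc : ψ ⟨refl R 1, refl_one_mem f hf⟩ = ⟨refl R 1, refl_one_mem f' hf'⟩) (n : ℕ) :
    ∃ σ : group f hf, σ.1 = twist (fun _ => f n + f (-n)) ∧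
      (ψ σ).1 = twist (fun _ => f' n + f' (-n)) := by
  have key : ∃ σ : group f hf, σ.1 = lamp f hf n ∧ (ψ σ).1 = lamp f' hf' n := by
    induction n with
    | zero => exact ⟨⟨lamp f hf 0, lamp_mem f hf⟩, by simp, by rw [hx]; simp⟩
    | succ n ih =>
      obtain ⟨σ, h1, h2⟩ := ih
      have hstep (f : ZMod m → R) (hf : f 0 = 0) :
          refl R 1 * (refl R 0 * lamp f hf n * refl R 0) * refl R 1 =
            lamp f hf ((n + 1 : ℕ) : ZMod m) := by
        rw [refl_mul_lamp_mul_refl, refl_mul_lamp_mul_refl]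
        congr 1
        push_cast
        ring
      refine ⟨⟨refl R 1, refl_one_mem f hf⟩ * (⟨refl R 0, refl_zero_mem f hf⟩ * σ *
        ⟨refl R 0, refl_zero_mem f hf⟩) * ⟨refl R 1, refl_one_mem f hf⟩, ?_, ?_⟩
      · rw [← hstep, ← h1]; rfl
      · simp only [map_mul, hb, hc]
        rw [← hstep, ← h2]; rfl
  obtain ⟨σ, h1, h2⟩ := key
  refine ⟨⟨lamp f hf 0, lamp_mem f hf⟩ * σ * ⟨lamp f hf 0, lamp_mem f hf⟩ * σ, ?_, ?_⟩
  · rw [← commutator_lamp f hf, ← h1]; rfl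
  · simp only [map_mul, hx]
    rw [← commutator_lamp f' hf', ← h2]; rfl

/-- The form on the cycle of length `4 * r + 8` whose commutators list the standard basis
followed by the rows of the matrix `M`. -/
def profile {r : ℕ} (M : Fin r → Fin r → ZMod 2) (k : ZMod (4 * r + 8)) : Fin r → ZMod 2 :=
  if h : 2 ≤ k.val ∧ k.val < r + 2 then Pi.single ⟨k.val - 2, by omega⟩ 1
  else if h : r + 2 ≤ k.val ∧ k.val < 2 * r + 2 then M ⟨k.val - (r + 2), by omega⟩
  else 0

theorem val_neg_natCast {r n : ℕ} (hn : 0 < n) (hn' : n < 4 * r + 8) :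
    (-(n : ZMod (4 * r + 8))).val = 4 * r + 8 - n := by
  have h : -(n : ZMod (4 * r + 8)) = ((4 * r + 8 - n : ℕ) : ZMod (4 * r + 8)) := by
    rw [Nat.cast_sub hn'.le, ZMod.natCast_self, zero_sub]
  rw [h, ZMod.val_natCast_of_lt (by omega)]

theorem profile_neg {r n : ℕ} (M : Fin r → Fin r → ZMod 2) (hn : 0 < n) (hn' : n < 2 * r + 2) :
    profile M (-(n : ZMod (4 * r + 8))) = 0 := by
  have hv := val_neg_natCast hn (show n < 4 * r + 8 by omega)
  unfold profile
  rw [dif_neg (by omega), dif_neg (by omega)]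

theorem profile_zero {r : ℕ} (M : Fin r → Fin r → ZMod 2) : profile M 0 = 0 := by
  simp [profile]

theorem profile_one {r : ℕ} (M : Fin r → Fin r → ZMod 2) : profile M 1 + profile M (-1) = 0 := by
  have h1 : profile M 1 = 0 := by
    have : (1 : ZMod (4 * r + 8)).val = 1 := by
      simpa using ZMod.val_natCast_of_lt (show 1 < 4 * r + 8 by omega)
    unfold profile
    rw [dif_neg (by omega), dif_neg (by omega)]
  have h2 := profile_neg M one_pos (by omega)
  rw [Nat.cast_one] at h2
  rw [h1, h2, add_zero]

theorem profile_basis {r : ℕ} (M : Fin r → Fin r → ZMod 2) (i : Fin r) :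
    profile M ((i + 2 : ℕ) : ZMod (4 * r + 8)) = Pi.single i 1 := by
  have := i.2
  have hv := ZMod.val_natCast_of_lt (show i + 2 < 4 * r + 8 by omega)
  unfold profile
  rw [dif_pos (by omega)]
  congr 1
  ext
  simp only [hv]
  omega

theorem profile_row {r : ℕ} (M : Fin r → Fin r → ZMod 2) (i : Fin r) :
    profile M ((i + (r + 2) : ℕ) : ZMod (4 * r + 8)) = M i := by
  have := i.2
  have hv := ZMod.val_natCast_of_lt (show i + (r + 2) < 4 * r + 8 by omega)
  unfold profile
  rw [dif_neg (by omega), dif_pos (by omega)]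
  congr 1
  ext
  simp only [hv]
  omega

/-- The rigid triple attached to a matrix over `ZMod 2`. -/
abbrev matrixTriple {r : ℕ} (M : Fin r → Fin r → ZMod 2) :
    RigidTriple (group (profile M) (profile_zero M)) :=
  rigidTriple (profile M) (profile_zero M) (profile_one M) (by omega)

/-- The Cayley graph attached to a matrix determines the matrix. -/
theorem eq_of_iso {r : ℕ} {M M' : Fin r → Fin r → ZMod 2}
    (φ : (matrixTriple M).graph ≃g (matrixTriple M').graph) : M = M' := by
  obtain ⟨ψ, hx, hb, hc⟩ := (matrixTriple M).exists_hom (matrixTriple M') φ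
  let p : (Fin r → ZMod 2) → (Fin r → ZMod 2) → Prop := fun v v' =>
    ∃ σ : group (profile M) (profile_zero M), σ.1 = twist (fun _ => v) ∧
      (ψ σ).1 = twist (fun _ => v')
  have hp (n : ℕ) (hn : 0 < n) (hn' : n < 2 * r + 2) : p (profile M n) (profile M' n) := by
    have h := exists_twist ψ hx hb hc n
    rwa [profile_neg M hn hn', profile_neg M' hn hn', add_zero, add_zero] at h
  have hzero : p 0 0 := ⟨1, by exact twist_zero.symm, by rw [map_one]; exact twist_zero.symm⟩
  have hadd {v v' w w'} : p v v' → p w w' → p (v + w) (v' + w') := by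
    rintro ⟨σ, h1, h2⟩ ⟨τ, h3, h4⟩
    refine ⟨σ * τ, ?_, ?_⟩
    · rw [Subgroup.coe_mul, h1, h3, ← twist_add]; rfl
    · rw [map_mul, Subgroup.coe_mul, h2, h4, ← twist_add]; rfl
  have hdiag (v : Fin r → ZMod 2) : p v v := by
    rw [← Finset.univ_sum_single v]
    refine Finset.sum_induction _ (fun v => p v v) (fun _ _ => hadd) hzero fun i _ => ?_
    have hcases : ∀ a : ZMod 2, a = 0 ∨ a = 1 := by decide
    rcases hcases (v i) with h | h <;> rw [h]
    · simpa using hzero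
    · simpa only [profile_basis] using hp (i + 2) (by omega) (by omega)
  funext i
  obtain ⟨σ, h1, h2⟩ := hp (i + (r + 2)) (by omega) (by omega)
  rw [profile_row] at h1 h2
  obtain ⟨τ, h3, h4⟩ := hdiag (M i)
  obtain rfl : σ = τ := Subtype.ext (h1.trans h3.symm)
  exact congrFun (twist_injective (h4.symm.trans h2)) 1

theorem card_group_profile_le {r : ℕ} (M : Fin r → Fin r → ZMod 2) :
    Nat.card (group (profile M) (profile_zero M)) ≤ 2 ^ (7 * r + 12) := by
  refine (card_group_le _ _).trans ?_
  have h : r + 2 ≤ 2 ^ (r + 1) := (Nat.lt_two_pow_self (n := r + 1))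
  calc 2 ^ (4 * r + 8) * Nat.card (Fin r → ZMod 2) ^ 2 * (2 * (4 * r + 8))
      = 2 ^ (6 * r + 11) * (r + 2) := by simp; ring
    _ ≤ 2 ^ (6 * r + 11) * 2 ^ (r + 1) := by gcongr
    _ = 2 ^ (7 * r + 12) := by ring

end Lamp

/-! ### Counting -/

theorem DValent.of_iso {V W : Type*} {Γ : SimpleGraph V} {Δ : SimpleGraph W} {d : ℕ}
    (h : DValent Γ d) (e : Γ ≃g Δ) : DValent Δ d := fun w => by
  have := Nat.card_congr (e.symm.mapNeighborSet w)
  rwa [Nat.card_coe_set_eq, Nat.card_coe_set_eq, h] at this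

theorem IsGRR.of_iso {V W : Type*} {Γ : SimpleGraph V} {Δ : SimpleGraph W}
    (h : IsGRR Γ) (e : Γ ≃g Δ) : IsGRR Δ := fun u v => by
  obtain ⟨φ, hφ, huniq⟩ := h (e.symm u) (e.symm v)
  refine ⟨(e.symm.trans φ).trans e, by simp [hφ], fun χ hχ => ?_⟩
  have h := huniq ((e.trans χ).trans e.symm) (by simp [hχ])
  rw [← h]
  ext w
  simp

theorem finite_graphs_of_le {P : GSig → Prop} {n : ℕ} (hP : ∀ x, P x → x.1 ≤ n) :
    Finite {x : GSig // P x} := by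
  refine Finite.of_injective (β := Σ k : Fin (n + 1), SimpleGraph (Fin k))
    (fun x => ⟨⟨x.1.1, Nat.lt_succ_of_le (hP _ x.2)⟩, x.1.2⟩) ?_
  rintro ⟨⟨k, Γ⟩, hx⟩ ⟨⟨l, Δ⟩, hy⟩ h
  simp only [Sigma.mk.injEq, Fin.mk.injEq] at h
  obtain ⟨rfl, h⟩ := h
  obtain rfl := eq_of_heq h
  rfl

theorem two_pow_sq_le_grrCount {r n : ℕ} (hn : 2 ^ (7 * r + 12) ≤ n) : 2 ^ r ^ 2 ≤ grrCount n := by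
  let P : GSig → Prop := fun x => x.1 ≤ n ∧ x.2.Connected ∧ DValent x.2 3 ∧ IsGRR x.2
  have hfin : Finite {x : GSig // P x} := finite_graphs_of_le fun x hx => hx.1
  have hex (M : Fin r → Fin r → ZMod 2) : ∃ x : {x : GSig // P x},
      Nonempty ((Lamp.matrixTriple M).graph ≃g x.1.2) := by
    let T := Lamp.matrixTriple M
    let e := SimpleGraph.Iso.map (Finite.equivFin _) T.graph
    exact ⟨⟨⟨_, _⟩, (Lamp.card_group_profile_le M).trans hn, e.connected_iff.1 T.connected_graph,
      T.dValent_graph.of_iso e, T.isGRR_graph.of_iso e⟩, ⟨e⟩⟩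
  choose x hx using hex
  have hinj : Function.Injective fun M => (Quotient.mk (graphSetoid P) (x M)) := by
    intro M M' h
    obtain ⟨e⟩ : Nonempty ((x M).1.2 ≃g (x M').1.2) := Quotient.exact h
    obtain ⟨e₁⟩ := hx M
    obtain ⟨e₂⟩ := hx M'
    exact Lamp.eq_of_iso ((e₁.trans e).trans e₂.symm)
  refine le_trans ?_ (Nat.card_le_card_of_injective _ hinj)
  simp [← pow_mul, sq]

/-- There exist positive constants `a`, `c` such that for every `n ≥ 1`,
`GRR_3(n) ≥ n^(a·log n) − c`. -/
theorem grr3_lower_bound :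
    ∃ a c : ℝ, 0 < a ∧ 0 < c ∧ ∀ n : ℕ, 1 ≤ n →
      (n : ℝ) ^ (a * Real.log n) - c ≤ grrCount n := by
  refine ⟨1 / 676, 2 ^ 19, by norm_num, by norm_num, fun n hn => ?_⟩
  have hn0 : (0 : ℝ) < n := by exact_mod_cast hn
  have hlog0 : 0 ≤ Real.log n := Real.log_natCast_nonneg n
  have hlog2 : Real.log 2 < 1 := Real.log_two_lt_d9.trans (by norm_num)
  have hlog2' : 0 < Real.log 2 := Real.log_pos one_lt_two
  have hlog_le {k : ℕ} (h : n ≤ 2 ^ k) : Real.log n ≤ k * Real.log 2 := by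
    rw [← Real.log_pow]
    exact Real.log_le_log hn0 (by exact_mod_cast h)
  rcases lt_or_ge n (2 ^ 19) with hsmall | hlarge
  · have h1 : (n : ℝ) ^ (1 / 676 * Real.log n) ≤ (n : ℝ) ^ (1 : ℝ) := by
      refine Real.rpow_le_rpow_of_exponent_le (by exact_mod_cast hn) ?_
      have := hlog_le hsmall.le
      push_cast at this
      linarith
    have h2 : (n : ℝ) ≤ 2 ^ 19 := by exact_mod_cast hsmall.le
    rw [Real.rpow_one] at h1
    have h3 : (0 : ℝ) ≤ grrCount n := Nat.cast_nonneg _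
    linarith
  · have hL : 19 ≤ Nat.log 2 n := by
      simpa only [Nat.log_pow one_lt_two] using Nat.log_mono_right (b := 2) hlarge
    obtain ⟨r, hr, hr1, hr2⟩ : ∃ r, 1 ≤ r ∧ 7 * r + 12 ≤ Nat.log 2 n ∧ Nat.log 2 n ≤ 7 * r + 18 :=
      ⟨(Nat.log 2 n - 12) / 7, by omega, by omega, by omega⟩
    have hcount : 2 ^ r ^ 2 ≤ grrCount n := two_pow_sq_le_grrCount
      ((Nat.pow_le_pow_right two_pos hr1).trans (Nat.pow_log_le_self 2 (by omega)))
    have hnr : n ≤ 2 ^ (26 * r) :=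
      (Nat.lt_pow_succ_log_self one_lt_two n).le.trans (Nat.pow_le_pow_right two_pos (by omega))
    have hlogn := hlog_le hnr
    push_cast at hlogn
    have hexp : Real.log n * (1 / 676 * Real.log n) ≤ Real.log 2 * (r ^ 2 : ℕ) := by
      have h1 : Real.log n ^ 2 ≤ (26 * r * Real.log 2) ^ 2 := pow_le_pow_left₀ hlog0 hlogn 2
      have h2 : (r : ℝ) ^ 2 * (Real.log 2 * Real.log 2) ≤ (r : ℝ) ^ 2 * Real.log 2 := by
        gcongr
        nlinarith
      push_cast
      nlinarith
    have h : (n : ℝ) ^ (1 / 676 * Real.log n) ≤ 2 ^ r ^ 2 := by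
      rw [Real.rpow_def_of_pos hn0, ← Real.rpow_natCast, Real.rpow_def_of_pos two_pos]
      exact Real.exp_le_exp.2 hexp
    have h' : (2 : ℝ) ^ r ^ 2 ≤ grrCount n := by exact_mod_cast hcount
    have h'' : (0 : ℝ) < 2 ^ 19 := by norm_num
    linarith
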